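/- Let M be a submonoid of the monoid H(τ) of hypersubstitutions of type τ. For every set Σ of quasi-identities of type τ and every quasi-identity e of type τ: e is derivable from Σ in the calculus MHQ if and only if e is derivable from (8.4)(Σ) in the calculus Q. In symbols: Σ ⊢_HQ^M e if and only if (8.4)(Σ) ⊢_Q e. -/

import Mathlib

open scoped Classical

/-- Terms of a type `τ = (I, ar)`: an indexed family of operation symbols `I`
with arities `ar`, over countably many variables. -/
inductive Trm (I : Type) (ar : I → ℕ) : Type
  | var : ℕ → Trm I ar
  | app (f : I) : (Fin (ar f) → Trm I ar) → Trm I ar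

variable {I : Type} {ar : I → ℕ}

/-- Simultaneous substitution of terms for variables. -/
def Trm.subst (δ : ℕ → Trm I ar) : Trm I ar → Trm I ar
  | .var n => δ n
  | .app f ts => .app f fun i => (ts i).subst δ

/-- A hypersubstitution assigns to each operation symbol `f` a term `σ(f)`. -/
def Hyp (I : Type) (ar : I → ℕ) := (f : I) → Trm I ar

/-- The extension of a hypersubstitution to all terms. -/
def Hyp.apply (σ : Hyp I ar) : Trm I ar → Trm I ar
  | .var n => .var n
  | .app f ts => (σ f).subst fun n => if h : n < ar f then σ.apply (ts ⟨n, h⟩) else .var n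

/-- The identity hypersubstitution `σ_id`. -/
def Hyp.id (I : Type) (ar : I → ℕ) : Hyp I ar := fun f => .app f fun i => .var i

/-- Composition of hypersubstitutions: `(σ₁ ∘ σ₂)(f) = σ₁(σ₂(f))`. -/
def Hyp.comp (σ₁ σ₂ : Hyp I ar) : Hyp I ar := fun f => σ₁.apply (σ₂ f)

/-- Occurrence of the variable `m` in a term. -/
inductive Occurs (m : ℕ) : Trm I ar → Prop
  | var : Occurs m (.var m)
  | app {f ts} (i : Fin (ar f)) : Occurs m (ts i) → Occurs m (.app f ts)

/-- `σ` is a genuine hypersubstitution: `σ(f)` is an `(ar f)`-ary term,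
i.e. its variables are among `x₀, …, x_{ar f - 1}`.  The set `{σ | IsHyp σ}`
plays the role of the monoid `H(τ)` of all hypersubstitutions of type `τ`. -/
def IsHyp (σ : Hyp I ar) : Prop := ∀ f m, Occurs m (σ f) → m < ar f

/-- An identity `t ≈ s` of type `τ`. -/
abbrev Eqn (I : Type) (ar : I → ℕ) := Trm I ar × Trm I ar

/-- A quasi-identity `Δ → α` of type `τ`: a finite set `Δ` of identities
(the premises) together with an identity `α` (the conclusion). -/
abbrev Quasi (I : Type) (ar : I → ℕ) := Finset (Eqn I ar) × Eqn I ar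

/-- Applying a map on terms to every term occurring in a quasi-identity. -/
noncomputable def mapQ (g : Trm I ar → Trm I ar) (q : Quasi I ar) : Quasi I ar :=
  (q.1.image fun p => (g p.1, g p.2), (g q.2.1, g q.2.2))

/-- An algebra of type `τ`. -/
structure Alg (I : Type) (ar : I → ℕ) where
  carrier : Type
  ops : (f : I) → (Fin (ar f) → carrier) → carrier

/-- Evaluation of a term in an algebra under an assignment `v`. -/
def Alg.eval (A : Alg I ar) (v : ℕ → A.carrier) : Trm I ar → A.carrier
  | .var n => v n
  | .app f ts => A.ops f fun i => A.eval v (ts i)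

/-- Satisfaction of a quasi-identity in an algebra: every assignment making all
premises hold makes the conclusion hold. -/
def Alg.Sat (A : Alg I ar) (q : Quasi I ar) : Prop :=
  ∀ v : ℕ → A.carrier,
    (∀ p ∈ q.1, A.eval v p.1 = A.eval v p.2) → A.eval v q.2.1 = A.eval v q.2.2

/-- `M`-hypersatisfaction of a quasi-identity in an algebra: `A` satisfies
`σ(q)` for every hypersubstitution `σ ∈ M`. -/
def Alg.HypSatM (A : Alg I ar) (M : Set (Hyp I ar)) (q : Quasi I ar) : Prop :=
  ∀ σ ∈ M, A.Sat (mapQ (Hyp.apply σ) q)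

/-- The quasi-equational calculus `Q` (when `M = ∅`), resp. its extension by the
hypersubstitution rule for the hypersubstitutions of `M`: `MHQ` for a submonoid
`M ⊆ H(τ)`, and `HQ` when `M = {σ | IsHyp σ} = H(τ)`. -/
inductive Der (M : Set (Hyp I ar)) (S : Set (Quasi I ar)) : Quasi I ar → Prop
  | hyp {q} : q ∈ S → Der M S q
  | refl (p : Trm I ar) : Der M S (∅, (p, p))
  | assm (α : Eqn I ar) : Der M S ({α}, α)
  | symm (p q : Trm I ar) : Der M S ({(p, q)}, (q, p))
  | trans (p q r : Trm I ar) : Der M S ({(p, q), (q, r)}, (p, r))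
  | compat (f : I) (t s : Fin (ar f) → Trm I ar) :
      Der M S (Finset.univ.image fun i => (t i, s i), (.app f t, .app f s))
  | subst {q} (δ : ℕ → Trm I ar) : Der M S q → Der M S (mapQ (Trm.subst δ) q)
  | hypsub {q} {σ : Hyp I ar} : σ ∈ M → Der M S q → Der M S (mapQ (Hyp.apply σ) q)
  | cut {Δ Γ : Finset (Eqn I ar)} {α β : Eqn I ar} :
      Der M S (Δ, α) → Der M S (insert α Γ, β) → Der M S (Δ ∪ Γ, β)
  | ext {Δ : Finset (Eqn I ar)} {α : Eqn I ar} (β : Eqn I ar) :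
      Der M S (Δ, α) → Der M S (insert β Δ, α)

theorem Trm.subst_var (t : Trm I ar) : t.subst Trm.var = t := by
  induction t with
  | var n => rfl
  | app f ts ih => simp [Trm.subst, ih]

theorem Trm.subst_subst (δ ε : ℕ → Trm I ar) (t : Trm I ar) :
    (t.subst δ).subst ε = t.subst fun n => (δ n).subst ε := by
  induction t with
  | var n => rfl
  | app f ts ih => simp [Trm.subst, ih]

theorem Trm.subst_congr {δ ε : ℕ → Trm I ar} {t : Trm I ar}
    (h : ∀ m, Occurs m t → δ m = ε m) : t.subst δ = t.subst ε := by
  induction t with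
  | var n => exact h n .var
  | app f ts ih =>
    simp only [Trm.subst, Trm.app.injEq, heq_eq_eq, true_and]
    exact funext fun i => ih i fun m hm => h m (.app i hm)

theorem Hyp.id_apply (t : Trm I ar) : (Hyp.id I ar).apply t = t := by
  induction t with
  | var n => rfl
  | app f ts ih =>
    simp only [Hyp.apply, ih]
    simp [Hyp.id, Trm.subst]

theorem Hyp.apply_subst {σ : Hyp I ar} (hσ : IsHyp σ) (δ : ℕ → Trm I ar) (t : Trm I ar) :
    σ.apply (t.subst δ) = (σ.apply t).subst fun n => σ.apply (δ n) := by
  induction t with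
  | var n => rfl
  | app f ts ih =>
    simp only [Hyp.apply, Trm.subst, Trm.subst_subst]
    refine Trm.subst_congr fun m hm => ?_
    simp [hσ f m hm, ih]

theorem Hyp.comp_apply {σ₁ : Hyp I ar} (h₁ : IsHyp σ₁) (σ₂ : Hyp I ar) (t : Trm I ar) :
    (Hyp.comp σ₁ σ₂).apply t = σ₁.apply (σ₂.apply t) := by
  induction t with
  | var n => rfl
  | app f ts ih =>
    simp only [Hyp.apply, Hyp.apply_subst h₁]
    refine Trm.subst_congr fun m _ => ?_
    split_ifs
    · exact ih _
    · rfl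

theorem mapQ_mapQ (g h : Trm I ar → Trm I ar) (q : Quasi I ar) :
    mapQ g (mapQ h q) = mapQ (fun t => g (h t)) q := by
  simp [mapQ, Finset.image_image, Function.comp_def]

theorem mapQ_of_forall_eq {g : Trm I ar → Trm I ar} (hg : ∀ t, g t = t) (q : Quasi I ar) :
    mapQ g q = q := by
  simp [mapQ, hg]

namespace Der

variable {M : Set (Hyp I ar)} {S : Set (Quasi I ar)}

theorem weaken {Δ Γ : Finset (Eqn I ar)} {α : Eqn I ar} (h : Der M S (Δ, α)) (hΓ : Δ ⊆ Γ) :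
    Der M S (Γ, α) := by
  have key : ∀ Θ : Finset (Eqn I ar), Der M S (Θ ∪ Δ, α) := fun Θ => by
    induction Θ using Finset.induction_on with
    | empty => simpa using h
    | insert a Θ _ ih =>
      rw [Finset.insert_union]
      exact ih.ext a
  simpa [Finset.union_eq_left.2 hΓ] using key Γ

theorem cut_finset {Δ Γ : Finset (Eqn I ar)} {β : Eqn I ar}
    (hΓ : ∀ α ∈ Γ, Der M S (Δ, α)) (h : Der M S (Γ, β)) : Der M S (Δ, β) := by
  have key : Der M S (Γ ∪ Δ, β) → Der M S (Δ, β) := by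
    clear h
    induction Γ using Finset.induction_on with
    | empty => simp
    | insert a Γ _ ih =>
      intro h
      rw [Finset.insert_union] at h
      refine ih (fun α hα => hΓ α (Finset.mem_insert_of_mem hα)) ?_
      exact ((hΓ a (Finset.mem_insert_self a Γ)).cut h).weaken
        (Finset.union_subset Finset.subset_union_right subset_rfl)
  exact key (h.weaken Finset.subset_union_left)

theorem subst_compat {Δ : Finset (Eqn I ar)} {δ ε : ℕ → Trm I ar}
    (h : ∀ n, Der M S (Δ, (δ n, ε n))) (t : Trm I ar) :
    Der M S (Δ, (t.subst δ, t.subst ε)) := by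
  induction t with
  | var n => exact h n
  | app f ts ih =>
    refine cut_finset ?_ (Der.compat f _ _)
    intro α hα
    obtain ⟨i, -, rfl⟩ := Finset.mem_image.1 hα
    exact ih i

theorem mapQ_hyp {σ : Hyp I ar} (hσ : IsHyp σ)
    (hS : ∀ q ∈ S, mapQ σ.apply q ∈ S) {q : Quasi I ar} (h : Der ∅ S q) :
    Der ∅ S (mapQ σ.apply q) := by
  induction h with
  | hyp hq => exact .hyp (hS _ hq)
  | refl p => exact .refl _
  | assm α => simpa [mapQ] using Der.assm (M := ∅) (S := S) (σ.apply α.1, σ.apply α.2)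
  | symm p q => simpa [mapQ] using Der.symm (M := ∅) (S := S) (σ.apply p) (σ.apply q)
  | trans p q r =>
    simpa [mapQ, Finset.image_insert] using
      Der.trans (M := ∅) (S := S) (σ.apply p) (σ.apply q) (σ.apply r)
  | compat f t s =>
    refine subst_compat (fun n => ?_) (σ f)
    split_ifs with hn
    · refine (Der.assm _).weaken ?_
      rw [Finset.singleton_subset_iff, Finset.image_image]
      exact Finset.mem_image_of_mem _ (Finset.mem_univ (⟨n, hn⟩ : Fin (ar f)))
    · exact (Der.refl _).weaken (Finset.empty_subset _)
  | @subst q δ _ ih =>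
    have := ih.subst fun n => σ.apply (δ n)
    rw [mapQ_mapQ] at this ⊢
    simpa only [Hyp.apply_subst hσ] using this
  | hypsub hσ' => exact absurd hσ' (Set.notMem_empty _)
  | cut _ _ ih₁ ih₂ =>
    simp only [mapQ, Finset.image_insert, Finset.image_union] at ih₁ ih₂ ⊢
    exact ih₁.cut ih₂
  | ext β _ ih =>
    simp only [mapQ, Finset.image_insert] at ih ⊢
    exact ih.ext _

end Der

/-- Let `M` be a submonoid of `H(τ)`.  A derivation from `Σ` in `MHQ` is the
same as a derivation in `Q` from `(8.4)(Σ) = {σ(e) : e ∈ Σ, σ ∈ M}`: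
`Σ ⊢_HQ^M e ↔ (8.4)(Σ) ⊢_Q e`. -/
theorem derMHQ_iff_derQ_closure (M : Set (Hyp I ar))
    (hM : ∀ σ ∈ M, IsHyp σ) (hid : Hyp.id I ar ∈ M)
    (hcomp : ∀ σ₁ ∈ M, ∀ σ₂ ∈ M, Hyp.comp σ₁ σ₂ ∈ M)
    (S : Set (Quasi I ar)) (e : Quasi I ar) :
    Der M S e ↔
      Der ∅ {q' : Quasi I ar | ∃ q ∈ S, ∃ σ ∈ M, q' = mapQ (Hyp.apply σ) q} e := by
  constructor
  · intro h
    induction h with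
    | @hyp q hq =>
      exact .hyp ⟨q, hq, Hyp.id I ar, hid, (mapQ_of_forall_eq Hyp.id_apply q).symm⟩
    | refl p => exact .refl p
    | assm α => exact .assm α
    | symm p q => exact .symm p q
    | trans p q r => exact .trans p q r
    | compat f t s => exact .compat f t s
    | subst δ _ ih => exact ih.subst δ
    | @hypsub _ σ hσ _ ih =>
      refine ih.mapQ_hyp (hM σ hσ) ?_
      rintro _ ⟨q, hq, σ₂, hσ₂, rfl⟩
      refine ⟨q, hq, Hyp.comp σ σ₂, hcomp σ hσ σ₂ hσ₂, ?_⟩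
      rw [mapQ_mapQ]
      simp only [← Hyp.comp_apply (hM σ hσ)]
    | cut _ _ ih₁ ih₂ => exact ih₁.cut ih₂
    | ext β _ ih => exact ih.ext β
  · intro h
    induction h with
    | hyp hq =>
      obtain ⟨q, hq, σ, hσ, rfl⟩ := hq
      exact .hypsub hσ (.hyp hq)
    | refl p => exact .refl p
    | assm α => exact .assm α
    | symm p q => exact .symm p q
    | trans p q r => exact .trans p q r
    | compat f t s => exact .compat f t s
    | subst δ _ ih => exact ih.subst δ
    | hypsub hσ => exact absurd hσ (Set.notMem_empty _)
    | cut _ _ ih₁ ih₂ => exact ih₁.cut ih₂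
    | ext β _ ih => exact ih.ext β
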